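/- arXiv:1307.3583 — 3 statements merged into one kernel-verified Lean document; each statement's English description precedes it below -/
import Mathlib

section
/- Ai(x) > 0 for every x ≥ 0; in particular, all real zeros of the Airy function Ai are negative. -/
open MeasureTheory Filter Set

/-- The Airy function of the first kind, defined as
`Ai(x) = (1/π) · lim_{R→∞} ∫₀^R cos(t³/3 + x·t) dt`. -/
noncomputable def Ai (x : ℝ) : ℝ :=
  (1 / Real.pi) *
    limUnder Filter.atTop (fun R : ℝ => ∫ t in (0:ℝ)..R, Real.cos (t ^ 3 / 3 + x * t))

namespace AiryAux

open Topology

noncomputable def p (a t : ℝ) : ℝ := Real.exp (-a * t ^ 2) / t ^ 2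
noncomputable def q (a t : ℝ) : ℝ := Real.exp (-a * t ^ 2) * (2 * a / t ^ 3 + 2 / t ^ 5)
noncomputable def r (a t : ℝ) : ℝ :=
  Real.exp (-a * t ^ 2) * (4 * a ^ 2 / t ^ 2 + 10 * a / t ^ 4 + 10 / t ^ 6)
noncomputable def B (a t : ℝ) : ℝ :=
  Real.sin (t ^ 3 / 3) * p a t + (1 - Real.cos (t ^ 3 / 3)) * q a t
noncomputable def F (a R : ℝ) : ℝ := ∫ t in (0:ℝ)..R, Real.exp (-a * t ^ 2) * Real.cos (t ^ 3 / 3)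
noncomputable def H (a t : ℝ) : ℝ := F a t - B a t

lemma hasDerivAt_e (a t : ℝ) : HasDerivAt (fun t : ℝ => Real.exp (-a * t ^ 2))
    (Real.exp (-a * t ^ 2) * (-a * (2 * t))) t := by
  have h := ((hasDerivAt_pow 2 t).const_mul (-a)).exp
  simpa using h

lemma hasDerivAt_u (t : ℝ) : HasDerivAt (fun t : ℝ => t ^ 3 / 3) (t ^ 2) t := by
  have h := (hasDerivAt_pow 3 t).div_const 3
  refine HasDerivAt.congr_deriv h ?_
  norm_num

lemma hasDerivAt_p (a t : ℝ) (ht : 0 < t) : HasDerivAt (p a) (-(t ^ 2 * q a t)) t := by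
  have h := (hasDerivAt_e a t).div (hasDerivAt_pow 2 t) (by positivity)
  refine HasDerivAt.congr_deriv h ?_
  unfold q
  field_simp
  ring

lemma hasDerivAt_q (a t : ℝ) (ht : 0 < t) : HasDerivAt (q a) (-(r a t)) t := by
  have h := (hasDerivAt_e a t).mul
    (((hasDerivAt_const t (2 * a)).div (hasDerivAt_pow 3 t) (by positivity)).add
      ((hasDerivAt_const t (2 : ℝ)).div (hasDerivAt_pow 5 t) (by positivity)))
  refine HasDerivAt.congr_deriv h ?_
  unfold r
  simp only [Pi.add_apply, Pi.div_apply]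
  field_simp
  ring

lemma hasDerivAt_B (a t : ℝ) (ht : 0 < t) : HasDerivAt (B a)
    (Real.exp (-a * t ^ 2) * Real.cos (t ^ 3 / 3) - (1 - Real.cos (t ^ 3 / 3)) * r a t) t := by
  have h := ((hasDerivAt_u t).sin.mul (hasDerivAt_p a t ht)).add
    (((hasDerivAt_u t).cos.const_sub 1).mul (hasDerivAt_q a t ht))
  refine HasDerivAt.congr_deriv h ?_
  have : Real.exp (-a * t ^ 2) = t ^ 2 * p a t := by unfold p; field_simp
  rw [this]
  ring

lemma hasDerivAt_F (a t : ℝ) : HasDerivAt (F a)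
    (Real.exp (-a * t ^ 2) * Real.cos (t ^ 3 / 3)) t := by
  have hc : Continuous (fun t : ℝ => Real.exp (-a * t ^ 2) * Real.cos (t ^ 3 / 3)) := by fun_prop
  exact intervalIntegral.integral_hasDerivAt_right (hc.intervalIntegrable _ _)
    (hc.stronglyMeasurableAtFilter _ _) hc.continuousAt

lemma hasDerivAt_H (a t : ℝ) (ht : 0 < t) : HasDerivAt (H a)
    ((1 - Real.cos (t ^ 3 / 3)) * r a t) t := by
  have h := (hasDerivAt_F a t).sub (hasDerivAt_B a t ht)
  refine HasDerivAt.congr_deriv h ?_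
  ring

lemma r_pos (a t : ℝ) (ha : 0 ≤ a) (ht : 0 < t) : 0 < r a t := by unfold r; positivity
lemma q_nonneg (a t : ℝ) (ha : 0 ≤ a) (ht : 0 < t) : 0 ≤ q a t := by unfold q; positivity
lemma p_nonneg (a t : ℝ) : 0 ≤ p a t := by unfold p; positivity

lemma e_le (a t : ℝ) (ha : 0 ≤ a) : Real.exp (-a * t ^ 2) ≤ 1 := by
  apply Real.exp_le_one_iff.2
  nlinarith [mul_nonneg ha (sq_nonneg t)]

lemma p_le (a t : ℝ) (ha : 0 ≤ a) (ht : 0 < t) : p a t ≤ 1 / t ^ 2 := by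
  unfold p
  gcongr
  exact e_le a t ha

lemma q_le (a t : ℝ) (ha : 0 ≤ a) (ht : 0 < t) : q a t ≤ 2 * a / t ^ 3 + 2 / t ^ 5 := by
  unfold q
  exact mul_le_of_le_one_left (by positivity) (e_le a t ha)

lemma B_zero (a : ℝ) : B a 0 = 0 := by simp [B]

lemma B_small (a t : ℝ) (ha : 0 ≤ a) (ht : 0 < t) : |B a t| ≤ t / 3 + (a * t ^ 3 + t) / 9 := by
  unfold B
  have h1 : |Real.sin (t ^ 3 / 3)| ≤ t ^ 3 / 3 := by
    have := Real.abs_sin_le_abs (x := t ^ 3 / 3)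
    rwa [abs_of_pos (a := t ^ 3 / 3) (by positivity)] at this
  have h2 : 1 - Real.cos (t ^ 3 / 3) ≤ (t ^ 3 / 3) ^ 2 / 2 := by
    have := Real.one_sub_sq_div_two_le_cos (x := t ^ 3 / 3)
    linarith
  have h3 : 0 ≤ 1 - Real.cos (t ^ 3 / 3) := by linarith [Real.cos_le_one (t ^ 3 / 3)]
  have hp := p_nonneg a t
  have hq := q_nonneg a t ha ht
  calc _ ≤ |Real.sin (t ^ 3 / 3) * p a t| + |(1 - Real.cos (t ^ 3 / 3)) * q a t| := abs_add_le _ _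
    _ = |Real.sin (t ^ 3 / 3)| * p a t + (1 - Real.cos (t ^ 3 / 3)) * q a t := by
      rw [abs_mul, abs_mul, abs_of_nonneg hp, abs_of_nonneg hq, abs_of_nonneg h3]
    _ ≤ t ^ 3 / 3 * (1 / t ^ 2) + (t ^ 3 / 3) ^ 2 / 2 * (2 * a / t ^ 3 + 2 / t ^ 5) := by
      gcongr
      · exact p_le a t ha ht
      · exact q_le a t ha ht
    _ = _ := by field_simp; ring

lemma B_large (a t : ℝ) (ha : 0 ≤ a) (ht : 0 < t) :
    |B a t| ≤ 1 / t ^ 2 + 2 * (2 * a / t ^ 3 + 2 / t ^ 5) := by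
  unfold B
  have h1 : |Real.sin (t ^ 3 / 3)| ≤ 1 := Real.abs_sin_le_one _
  have h2 : 1 - Real.cos (t ^ 3 / 3) ≤ 2 := by linarith [Real.neg_one_le_cos (t ^ 3 / 3)]
  have h3 : 0 ≤ 1 - Real.cos (t ^ 3 / 3) := by linarith [Real.cos_le_one (t ^ 3 / 3)]
  have hp := p_nonneg a t
  have hq := q_nonneg a t ha ht
  calc _ ≤ |Real.sin (t ^ 3 / 3) * p a t| + |(1 - Real.cos (t ^ 3 / 3)) * q a t| := abs_add_le _ _
    _ = |Real.sin (t ^ 3 / 3)| * p a t + (1 - Real.cos (t ^ 3 / 3)) * q a t := by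
      rw [abs_mul, abs_mul, abs_of_nonneg hp, abs_of_nonneg hq, abs_of_nonneg h3]
    _ ≤ 1 * (1 / t ^ 2) + 2 * (2 * a / t ^ 3 + 2 / t ^ 5) := by
      gcongr
      · exact p_le a t ha ht
      · exact q_le a t ha ht
    _ = _ := by ring

lemma B_tendsto (a : ℝ) (ha : 0 ≤ a) : Tendsto (B a) atTop (𝓝 0) := by
  have key : Tendsto (fun t : ℝ => 1 / t ^ 2 + 2 * (2 * a / t ^ 3 + 2 / t ^ 5)) atTop (𝓝 0) := by
    have h2 : Tendsto (fun t : ℝ => 1 / t ^ 2) atTop (𝓝 0) :=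
      tendsto_const_nhds.div_atTop (tendsto_pow_atTop (by norm_num))
    have h3 : Tendsto (fun t : ℝ => 2 * a / t ^ 3) atTop (𝓝 0) :=
      tendsto_const_nhds.div_atTop (tendsto_pow_atTop (by norm_num))
    have h5 : Tendsto (fun t : ℝ => 2 / t ^ 5) atTop (𝓝 0) :=
      tendsto_const_nhds.div_atTop (tendsto_pow_atTop (by norm_num))
    simpa using h2.add ((h3.add h5).const_mul 2)
  refine squeeze_zero_norm' ?_ key
  filter_upwards [eventually_gt_atTop 0] with t ht
  exact B_large a t ha ht

lemma B_cont (a : ℝ) (ha : 0 ≤ a) : ContinuousOn (B a) (Ici 0) := by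
  intro t ht
  rcases eq_or_lt_of_le (show (0:ℝ) ≤ t from ht) with h | h
  · subst h
    unfold ContinuousWithinAt
    rw [B_zero]
    have key : Tendsto (fun t : ℝ => t / 3 + (a * t ^ 3 + t) / 9) (𝓝[Ici 0] 0) (𝓝 0) := by
      have : Continuous (fun t : ℝ => t / 3 + (a * t ^ 3 + t) / 9) := by fun_prop
      have h := this.tendsto 0
      norm_num at h
      exact h.mono_left nhdsWithin_le_nhds
    refine squeeze_zero_norm' ?_ key
    filter_upwards [self_mem_nhdsWithin] with t ht
    rcases eq_or_lt_of_le (show (0:ℝ) ≤ t from ht) with h | h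
    · subst h; simp [B_zero]
    · exact B_small a t ha h
  · exact (hasDerivAt_B a t h).continuousAt.continuousWithinAt

lemma H_cont (a : ℝ) (ha : 0 ≤ a) : ContinuousOn (H a) (Ici 0) :=
  ContinuousOn.sub (fun t _ => (hasDerivAt_F a t).continuousAt.continuousWithinAt) (B_cont a ha)

lemma H_zero (a : ℝ) : H a 0 = 0 := by simp [H, F, B_zero]

lemma H_mono (a : ℝ) (ha : 0 ≤ a) : MonotoneOn (H a) (Ici 0) := by
  refine monotoneOn_of_deriv_nonneg (convex_Ici 0) (H_cont a ha) ?_ ?_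
  · intro t ht
    rw [interior_Ici] at ht
    exact (hasDerivAt_H a t ht).differentiableAt.differentiableWithinAt
  · intro t ht
    rw [interior_Ici] at ht
    rw [(hasDerivAt_H a t ht).deriv]
    exact mul_nonneg (by linarith [Real.cos_le_one (t ^ 3 / 3)]) (r_pos a t ha ht).le

lemma H_one_pos (a : ℝ) (ha : 0 ≤ a) : 0 < H a 1 := by
  have : StrictMonoOn (H a) (Icc 0 1) := by
    refine strictMonoOn_of_deriv_pos (convex_Icc 0 1)
      ((H_cont a ha).mono Icc_subset_Ici_self) ?_
    intro t ht
    rw [interior_Icc] at ht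
    rw [(hasDerivAt_H a t ht.1).deriv]
    refine mul_pos ?_ (r_pos a t ha ht.1)
    have h0 : 0 < t := ht.1
    have h1 : t ^ 3 ≤ 1 := pow_le_one₀ h0.le ht.2.le
    have := Real.cos_lt_cos_of_nonneg_of_le_pi (x := 0) (y := t ^ 3 / 3) le_rfl
      (by linarith [Real.pi_gt_three]) (by positivity)
    rw [Real.cos_zero] at this
    linarith
  have h := this (show (0:ℝ) ∈ Icc (0:ℝ) 1 by simp) (show (1:ℝ) ∈ Icc (0:ℝ) 1 by simp) one_pos
  rwa [H_zero] at h

lemma H_bdd (a : ℝ) (ha : 0 ≤ a) (t : ℝ) (ht : 1 ≤ t) : H a t ≤ H a 1 + 2 * q a 1 := by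
  have hd : ∀ t : ℝ, 0 < t → HasDerivAt (fun t => H a t + 2 * q a t)
      ((1 - Real.cos (t ^ 3 / 3)) * r a t + 2 * (-(r a t))) t := fun t ht =>
    (hasDerivAt_H a t ht).add ((hasDerivAt_q a t ht).const_mul 2)
  have : AntitoneOn (fun t => H a t + 2 * q a t) (Ici 1) := by
    refine antitoneOn_of_deriv_nonpos (convex_Ici 1) ?_ ?_ ?_
    · intro t ht
      exact (hd t (lt_of_lt_of_le one_pos ht)).continuousAt.continuousWithinAt
    · intro t ht
      rw [interior_Ici] at ht
      exact (hd t (one_pos.trans ht)).differentiableAt.differentiableWithinAt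
    · intro t ht
      rw [interior_Ici] at ht
      rw [(hd t (one_pos.trans ht)).deriv]
      nlinarith [r_pos a t ha (one_pos.trans ht), Real.neg_one_le_cos (t ^ 3 / 3)]
  have h := this (show (1:ℝ) ∈ Ici (1:ℝ) by simp) ht ht
  have := q_nonneg a t ha (by linarith)
  simp only at h
  linarith

lemma F_tendsto (a : ℝ) (ha : 0 ≤ a) : ∃ L : ℝ, 0 < L ∧ Tendsto (F a) atTop (𝓝 L) := by
  have hm : Monotone (fun t : ℝ => H a (max t 1)) := by
    intro s t hst
    exact H_mono a ha (show (0:ℝ) ≤ max s 1 by positivity)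
      (show (0:ℝ) ≤ max t 1 by positivity) (max_le_max_right 1 hst)
  have hb : BddAbove (range (fun t : ℝ => H a (max t 1))) := by
    refine ⟨H a 1 + 2 * q a 1, ?_⟩
    rintro _ ⟨t, rfl⟩
    exact H_bdd a ha _ (le_max_right _ _)
  have ht := tendsto_atTop_ciSup hm hb
  refine ⟨⨆ t : ℝ, H a (max t 1), ?_, ?_⟩
  · refine lt_of_lt_of_le (H_one_pos a ha) ?_
    simpa using le_ciSup hb 1
  · have h2 := ht.add (B_tendsto a ha)
    rw [add_zero] at h2
    refine h2.congr' ?_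
    filter_upwards [eventually_ge_atTop 1] with t ht
    rw [max_eq_left ht]
    simp [H]

noncomputable def f (x : ℝ) (z : ℂ) : ℂ := Complex.exp (Complex.I * (z ^ 3 / 3 + x * z))

lemma f_eq (x s y : ℝ) : f x (s + y * Complex.I) =
    Complex.exp (((-(s ^ 2) * y + y ^ 3 / 3 - x * y : ℝ) : ℂ)
      + ((s ^ 3 / 3 - s * y ^ 2 + x * s : ℝ) : ℂ) * Complex.I) := by
  unfold f
  congr 1
  push_cast
  have hI : Complex.I ^ 2 = -1 := Complex.I_sq
  linear_combination ((s:ℂ) ^ 2 * y + s * y ^ 2 * Complex.I + (Complex.I ^ 2 - 1) * y ^ 3 / 3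
    + x * y) * hI

lemma f_re (x s y : ℝ) : (f x (s + y * Complex.I)).re =
    Real.exp (-(s ^ 2) * y + y ^ 3 / 3 - x * y) * Real.cos (s ^ 3 / 3 - s * y ^ 2 + x * s) := by
  rw [f_eq, Complex.exp_re]
  congr 2 <;> simp [-Complex.ofReal_sub, -Complex.ofReal_add]

lemma f_im (x s y : ℝ) : (f x (s + y * Complex.I)).im =
    Real.exp (-(s ^ 2) * y + y ^ 3 / 3 - x * y) * Real.sin (s ^ 3 / 3 - s * y ^ 2 + x * s) := by
  rw [f_eq, Complex.exp_im]
  congr 2 <;> simp [-Complex.ofReal_sub, -Complex.ofReal_add]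

lemma f_cont (x : ℝ) : Continuous (f x) := by unfold f; fun_prop

lemma re_int (g : ℝ → ℂ) (hg : Continuous g) (a b : ℝ) :
    (∫ t in a..b, g t).re = ∫ t in a..b, (g t).re :=
  (Complex.reCLM.intervalIntegral_comp_comm (hg.intervalIntegrable a b)).symm

lemma im_int (g : ℝ → ℂ) (hg : Continuous g) (a b : ℝ) :
    (∫ t in a..b, g t).im = ∫ t in a..b, (g t).im :=
  (Complex.imCLM.intervalIntegral_comp_comm (hg.intervalIntegrable a b)).symm

noncomputable def V (a R : ℝ) : ℝ :=
  ∫ y in (0:ℝ)..a, Real.exp (-(R ^ 2) * y + y ^ 3 / 3 - a ^ 2 * y) *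
    Real.sin (R ^ 3 / 3 - R * y ^ 2 + a ^ 2 * R)

lemma contour (a R : ℝ) : ∫ t in (0:ℝ)..R, Real.cos (t ^ 3 / 3 + a ^ 2 * t) =
    Real.exp (-(2 * a ^ 3 / 3)) * F a R + V a R := by
  have h := Complex.integral_boundary_rect_eq_zero_of_differentiableOn (f (a ^ 2)) 0
    (R + a * Complex.I) (by unfold f; fun_prop)
  have h := congrArg Complex.re h
  have hf := f_cont (a ^ 2)
  have c1 : Continuous (fun t : ℝ => f (a ^ 2) (t + (0:ℝ) * Complex.I)) := by fun_prop
  have c2 : Continuous (fun t : ℝ => f (a ^ 2) (t + a * Complex.I)) := by fun_prop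
  have c3 : Continuous (fun t : ℝ => f (a ^ 2) (R + t * Complex.I)) := by fun_prop
  have c4 : Continuous (fun t : ℝ => f (a ^ 2) ((0:ℝ) + t * Complex.I)) := by fun_prop
  have e1 : ((R:ℂ) + a * Complex.I).re = R := by simp
  have e2 : ((R:ℂ) + a * Complex.I).im = a := by simp
  rw [e1, e2, Complex.zero_re, Complex.zero_im] at h
  simp only [smul_eq_mul, Complex.add_re, Complex.sub_re, Complex.I_mul_re] at h
  rw [re_int _ c1, re_int _ c2, im_int _ c3, im_int _ c4] at h
  simp only [f_re, f_im] at h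
  have i1 : (∫ t in (0:ℝ)..R, Real.exp (-(t ^ 2) * 0 + 0 ^ 3 / 3 - a ^ 2 * 0) *
      Real.cos (t ^ 3 / 3 - t * 0 ^ 2 + a ^ 2 * t)) =
      ∫ t in (0:ℝ)..R, Real.cos (t ^ 3 / 3 + a ^ 2 * t) := by
    congr 1; ext t; simp
  have i2 : (∫ t in (0:ℝ)..R, Real.exp (-(t ^ 2) * a + a ^ 3 / 3 - a ^ 2 * a) *
      Real.cos (t ^ 3 / 3 - t * a ^ 2 + a ^ 2 * t)) = Real.exp (-(2 * a ^ 3 / 3)) * F a R := by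
    unfold F
    rw [← intervalIntegral.integral_const_mul]
    congr 1; ext t
    rw [← mul_assoc, ← Real.exp_add]
    congr 2 <;> ring
  have i4 : (∫ y in (0:ℝ)..a, Real.exp (-((0:ℝ) ^ 2) * y + y ^ 3 / 3 - a ^ 2 * y) *
      Real.sin ((0:ℝ) ^ 3 / 3 - 0 * y ^ 2 + a ^ 2 * 0)) = 0 := by
    simp
  rw [i1, i2, i4] at h
  unfold V
  linarith

lemma V_tendsto (a : ℝ) (ha : 0 ≤ a) : Tendsto (V a) atTop (𝓝 0) := by
  have h : Tendsto (V a) atTop (𝓝 (∫ y in (0:ℝ)..a, (0:ℝ))) := by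
    unfold V
    refine intervalIntegral.tendsto_integral_filter_of_dominated_convergence
      (fun y => Real.exp (y ^ 3 / 3 - a ^ 2 * y)) ?_ ?_ ?_ ?_
    · refine Eventually.of_forall fun R => Continuous.aestronglyMeasurable (by fun_prop)
    · refine Eventually.of_forall fun R => Eventually.of_forall fun y hy => ?_
      rw [uIoc_of_le ha] at hy
      rw [norm_mul, Real.norm_eq_abs, Real.norm_eq_abs, Real.abs_exp]
      refine (mul_le_of_le_one_right (Real.exp_pos _).le (Real.abs_sin_le_one _)).trans ?_
      apply Real.exp_le_exp.2
      nlinarith [mul_nonneg (sq_nonneg R) hy.1.le]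
    · exact Continuous.intervalIntegrable (by fun_prop) _ _
    · refine Eventually.of_forall fun y hy => ?_
      rw [uIoc_of_le ha] at hy
      have hy0 : 0 < y := hy.1
      have key : Tendsto (fun R : ℝ => Real.exp (-(R ^ 2) * y + y ^ 3 / 3 - a ^ 2 * y))
          atTop (𝓝 0) := by
        apply Real.tendsto_exp_atBot.comp
        have h1 : Tendsto (fun R : ℝ => R ^ 2 * y) atTop atTop :=
          (tendsto_pow_atTop (by norm_num)).atTop_mul_const hy0
        have h2 := tendsto_atBot_add_const_right atTop (y ^ 3 / 3 - a ^ 2 * y)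
          (tendsto_neg_atTop_atBot.comp h1)
        refine h2.congr fun R => ?_
        simp only [Function.comp]
        ring
      refine squeeze_zero_norm (fun R => ?_) key
      rw [norm_mul, Real.norm_eq_abs, Real.norm_eq_abs, Real.abs_exp]
      exact mul_le_of_le_one_right (Real.exp_pos _).le (Real.abs_sin_le_one _)
  simpa using h

lemma Ai_pos (x : ℝ) (hx : 0 ≤ x) : 0 < Ai x := by
  obtain ⟨L, hL, hF⟩ := F_tendsto (Real.sqrt x) (Real.sqrt_nonneg x)
  have h := (hF.const_mul (Real.exp (-(2 * Real.sqrt x ^ 3 / 3)))).add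
    (V_tendsto (Real.sqrt x) (Real.sqrt_nonneg x))
  have h2 := h.congr fun R => (contour (Real.sqrt x) R).symm
  rw [Real.sq_sqrt hx, add_zero] at h2
  unfold Ai
  rw [h2.limUnder_eq]
  have := Real.pi_pos
  positivity

end AiryAux

/-- `Ai(x) > 0` for every `x ≥ 0`; in particular, all real zeros of the Airy function are
negative. -/
theorem airy_pos_on_nonneg_and_zeros_neg :
    (∀ x : ℝ, 0 ≤ x → 0 < Ai x) ∧ (∀ x : ℝ, Ai x = 0 → x < 0) := by
  refine ⟨AiryAux.Ai_pos, fun x hx => ?_⟩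
  by_contra! h
  exact (AiryAux.Ai_pos x h).ne' hx
end

section
/- For every a < 0 with Ai(a) = 0, the function x ↦ Ai(x + a) is square-integrable on (0,∞) and ∫₀^∞ Ai(x + a)² dx = (Ai'(a))². Equivalently, the L²(0,∞)-norm of the translate Ai(· − αₙ) equals |Ai'(−αₙ)| for every zero −αₙ of Ai. -/
open MeasureTheory Filter Set

/-- the complex integrand -/
noncomputable def airyE (x : ℝ) (z : ℂ) : ℂ :=
  Complex.exp (Complex.I * (z ^ 3 / 3 + x * z))

noncomputable def airyK (n : ℕ) (x : ℝ) : ℂ :=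
  ∫ t in Set.Ioi (0:ℝ), (Complex.I * ((t:ℂ) + Complex.I)) ^ n * airyE x ((t:ℂ) + Complex.I)

theorem airyE_norm (x t y : ℝ) : ‖airyE x ((t:ℂ) + y * Complex.I)‖
    = Real.exp (-(y * t ^ 2) + y ^ 3 / 3 - x * y) := by
  unfold airyE
  rw [Complex.norm_exp]
  congr 1
  have h : Complex.I * (((t:ℂ) + y * Complex.I) ^ 3 / 3 + x * ((t:ℂ) + y * Complex.I))
      = ((-(y * t ^ 2) + y ^ 3 / 3 - x * y : ℝ) : ℂ)
        + ((t ^ 3 / 3 - t * y ^ 2 + x * t : ℝ) : ℂ) * Complex.I := by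
    push_cast
    have h2 : Complex.I ^ 2 = -1 := Complex.I_sq
    have h3 : Complex.I ^ 3 = -Complex.I := by rw [pow_succ, h2]; ring
    have h4 : Complex.I ^ 4 = 1 := Complex.I_pow_four
    ring_nf
    simp only [h2, h3, h4]
    ring
  rw [h]
  simp only [Complex.add_re, Complex.ofReal_re, Complex.re_ofReal_mul, Complex.I_re]
  ring

theorem airyE_norm_one (x t : ℝ) : ‖airyE x ((t:ℂ) + Complex.I)‖
    = Real.exp (-(t ^ 2) + 1 / 3 - x) := by
  have := airyE_norm x t 1
  simpa using this

theorem airy_bound (n : ℕ) (x t : ℝ) (ht : 0 < t) :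
    ‖(Complex.I * ((t:ℂ) + Complex.I)) ^ n * airyE x ((t:ℂ) + Complex.I)‖
      ≤ (n.factorial * Real.exp (7 / 3) * Real.exp (-x)) * Real.exp (-t) := by
  rw [norm_mul, airyE_norm_one, norm_pow, norm_mul, Complex.norm_I, one_mul]
  have h1 : ‖(t:ℂ) + Complex.I‖ ≤ t + 1 := by
    refine (norm_add_le _ _).trans ?_
    rw [Complex.norm_I, Complex.norm_real, Real.norm_of_nonneg ht.le]
  have h2 : ‖(t:ℂ) + Complex.I‖ ^ n ≤ n.factorial * Real.exp (t + 1) := by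
    refine (pow_le_pow_left₀ (norm_nonneg _) h1 n).trans ?_
    have := Real.pow_div_factorial_le_exp (t + 1) (by linarith) n
    rw [div_le_iff₀ (by positivity)] at this
    linarith
  calc _ ≤ (n.factorial * Real.exp (t + 1)) * Real.exp (4 / 3 - 2 * t - x) := by
        gcongr
        nlinarith [sq_nonneg (t - 1)]
    _ = _ := by
        rw [mul_assoc, mul_assoc, mul_assoc, ← Real.exp_add, ← Real.exp_add, ← Real.exp_add]
        congr 2
        ring

theorem airy_cont (n : ℕ) (x : ℝ) : Continuous
    (fun t : ℝ => (Complex.I * ((t:ℂ) + Complex.I)) ^ n * airyE x ((t:ℂ) + Complex.I)) := by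
  unfold airyE
  fun_prop

theorem exp_int (C : ℝ) : IntegrableOn (fun t : ℝ => C * Real.exp (-t)) (Ioi 0) :=
  (integrableOn_exp_neg_Ioi 0).const_mul C

theorem airy_integrable (n : ℕ) (x : ℝ) : IntegrableOn
    (fun t : ℝ => (Complex.I * ((t:ℂ) + Complex.I)) ^ n * airyE x ((t:ℂ) + Complex.I))
    (Ioi 0) := by
  refine Integrable.mono' (exp_int _) (airy_cont n x).aestronglyMeasurable
    ((ae_restrict_iff' measurableSet_Ioi).2 (Eventually.of_forall fun t ht => airy_bound n x t ht))

theorem airyK_norm (n : ℕ) (x : ℝ) :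
    ‖airyK n x‖ ≤ n.factorial * Real.exp (7 / 3) * Real.exp (-x) := by
  unfold airyK
  refine (norm_integral_le_of_norm_le (exp_int _)
    ((ae_restrict_iff' measurableSet_Ioi).2
      (Eventually.of_forall fun t ht => airy_bound n x t ht))).trans ?_
  rw [integral_const_mul, integral_exp_neg_Ioi_zero, mul_one]

theorem airyK_deriv (n : ℕ) (x : ℝ) : HasDerivAt (airyK n) (airyK (n + 1) x) x := by
  have := hasDerivAt_integral_of_dominated_loc_of_deriv_le (μ := volume.restrict (Ioi (0:ℝ)))
    (F := fun (x t : ℝ) => (Complex.I * ((t:ℂ) + Complex.I)) ^ n * airyE x ((t:ℂ) + Complex.I))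
    (F' := fun (x t : ℝ) =>
      (Complex.I * ((t:ℂ) + Complex.I)) ^ (n+1) * airyE x ((t:ℂ) + Complex.I))
    (x₀ := x) (s := Metric.ball x 1)
    (bound := fun t => ((n+1).factorial * Real.exp (7 / 3) * Real.exp (-(x - 1))) * Real.exp (-t))
    (Metric.ball_mem_nhds x one_pos)
    (Eventually.of_forall fun y => (airy_cont n y).aestronglyMeasurable)
    (airy_integrable n x) (airy_cont (n+1) x).aestronglyMeasurable ?_ (exp_int _) ?_
  · exact this.2
  · refine (ae_restrict_iff' measurableSet_Ioi).2 (Eventually.of_forall fun t ht y hy => ?_)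
    refine (airy_bound (n+1) y t ht).trans ?_
    rw [Metric.mem_ball, Real.dist_eq, abs_lt] at hy
    gcongr
    linarith
  · refine Eventually.of_forall fun t y _ => ?_
    have h0 : HasDerivAt (fun y : ℝ => (y:ℂ)) 1 y := Complex.ofRealCLM.hasDerivAt
    have h1 : HasDerivAt (fun y : ℝ => Complex.I * (((t:ℂ) + Complex.I) ^ 3 / 3
        + y * ((t:ℂ) + Complex.I))) (Complex.I * (1 * ((t:ℂ) + Complex.I))) y :=
      ((h0.mul_const _).const_add _).const_mul _
    have h2 := (h1.cexp).const_mul ((Complex.I * ((t:ℂ) + Complex.I)) ^ n)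
    refine h2.congr_deriv ?_
    unfold airyE
    ring

theorem airyK_ode (x : ℝ) : (airyK 2 x).re = x * (airyK 0 x).re := by
  have hd : ∀ t ∈ Ici (0:ℝ), HasDerivAt (fun t : ℝ => Complex.I * airyE x ((t:ℂ) + Complex.I))
      ((Complex.I * ((t:ℂ) + Complex.I)) ^ 2 * airyE x ((t:ℂ) + Complex.I)
       - x * ((Complex.I * ((t:ℂ) + Complex.I)) ^ 0 * airyE x ((t:ℂ) + Complex.I))) t := by
    intro t _
    have h0 : HasDerivAt (fun y : ℝ => (y:ℂ) + Complex.I) 1 t :=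
      Complex.ofRealCLM.hasDerivAt.add_const _
    have h1 := (((((h0.pow 3).div_const 3).add (h0.const_mul (x:ℂ))).const_mul
      Complex.I).cexp).const_mul Complex.I
    refine h1.congr_deriv ?_
    unfold airyE
    simp only [Pi.add_apply, Pi.pow_apply]
    push_cast
    linear_combination (x * Complex.exp (Complex.I * (((t:ℂ) + Complex.I) ^ 3 / 3 + x * ((t:ℂ) + Complex.I)))) * Complex.I_sq
  have hi := (airy_integrable 2 x).sub ((airy_integrable 0 x).const_mul (x:ℂ))
  have ht : Tendsto (fun t : ℝ => Complex.I * airyE x ((t:ℂ) + Complex.I)) atTop (nhds 0) := by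
    rw [tendsto_zero_iff_norm_tendsto_zero]
    have : Tendsto (fun t : ℝ => (Nat.factorial 0 * Real.exp (7 / 3) * Real.exp (-x))
        * Real.exp (-t)) atTop (nhds 0) := by
      simpa using (Real.tendsto_exp_neg_atTop_nhds_zero).const_mul
        (Nat.factorial 0 * Real.exp (7 / 3) * Real.exp (-x))
    refine tendsto_of_tendsto_of_tendsto_of_le_of_le' tendsto_const_nhds this
      (Eventually.of_forall fun t => norm_nonneg _) ?_
    filter_upwards [eventually_gt_atTop 0] with t ht
    have := airy_bound 0 x t ht
    simpa using this
  have h := integral_Ioi_of_hasDerivAt_of_tendsto' hd hi ht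
  have e : ∫ t in Ioi (0:ℝ), ((Complex.I * ((t:ℂ) + Complex.I)) ^ 2 * airyE x ((t:ℂ) + Complex.I)
       - x * ((Complex.I * ((t:ℂ) + Complex.I)) ^ 0 * airyE x ((t:ℂ) + Complex.I)))
      = airyK 2 x - x * airyK 0 x := by
    unfold airyK
    rw [integral_sub (airy_integrable 2 x) ((airy_integrable 0 x).const_mul (x:ℂ)),
      integral_const_mul]
  rw [e] at h
  have hr : airyE x (((0:ℝ):ℂ) + Complex.I) = ((Real.exp (1 / 3 - x) : ℝ) : ℂ) := by
    unfold airyE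
    push_cast
    congr 1
    have h2 : Complex.I ^ 2 = -1 := Complex.I_sq
    have h4 : Complex.I ^ 4 = 1 := Complex.I_pow_four
    ring_nf
    simp only [h2, h4]
    ring
  rw [hr] at h
  have h' := congrArg Complex.re h
  simp only [Complex.sub_re, Complex.zero_re, Complex.mul_re,
    Complex.I_re, Complex.I_im, Complex.ofReal_im, Complex.ofReal_re] at h'
  linarith

theorem airy_rect (x R : ℝ) : (∫ t in (0:ℝ)..R, Real.cos (t ^ 3 / 3 + x * t))
    = (∫ t in (0:ℝ)..R, airyE x ((t:ℂ) + Complex.I)).re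
      + (∫ y in (0:ℝ)..1, airyE x ((R:ℂ) + y * Complex.I)).im := by
  have hdiff : Differentiable ℂ (airyE x) := by unfold airyE; fun_prop
  have h := Complex.integral_boundary_rect_eq_zero_of_differentiableOn (airyE x) 0
    ((R:ℂ) + Complex.I) hdiff.differentiableOn
  simp only [Complex.zero_re, Complex.zero_im, Complex.add_re, Complex.add_im, Complex.ofReal_re,
    Complex.ofReal_im, Complex.I_re, Complex.I_im, add_zero, zero_add, Complex.ofReal_zero,
    zero_mul, Complex.ofReal_one, one_mul, smul_eq_mul] at h
  have hleft : (∫ y in (0:ℝ)..1, airyE x (y * Complex.I)) =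
      ((∫ y in (0:ℝ)..1, Real.exp (y ^ 3 / 3 - x * y) : ℝ) : ℂ) := by
    rw [← intervalIntegral.integral_ofReal]
    congr 1
    ext y
    unfold airyE
    push_cast
    congr 1
    have h2 : Complex.I ^ 2 = -1 := Complex.I_sq
    have h4 : Complex.I ^ 4 = 1 := Complex.I_pow_four
    ring_nf
    simp only [h2, h4]
    ring
  have hbot : (∫ t in (0:ℝ)..R, airyE x t).re =
      ∫ t in (0:ℝ)..R, Real.cos (t ^ 3 / 3 + x * t) := by
    have hc : Continuous (fun t : ℝ => airyE x t) := hdiff.continuous.comp Complex.continuous_ofReal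
    have := Complex.reCLM.intervalIntegral_comp_comm (hc.intervalIntegrable (μ := volume) 0 R)
    simp only [Complex.reCLM_apply] at this
    rw [← this]
    congr 1
    ext t
    unfold airyE
    have : Complex.I * ((t:ℂ) ^ 3 / 3 + x * t) = ((t ^ 3 / 3 + x * t : ℝ) : ℂ) * Complex.I := by
      push_cast; ring
    rw [this, Complex.exp_ofReal_mul_I_re]
  rw [hleft] at h
  have h' := congrArg Complex.re h
  simp only [Complex.sub_re, Complex.add_re, Complex.zero_re, Complex.mul_re,
    Complex.I_re, Complex.I_im, Complex.ofReal_im, Complex.ofReal_re, hbot] at h'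
  linarith

theorem airy_side (x : ℝ) : Tendsto (fun R : ℝ =>
    (∫ y in (0:ℝ)..1, airyE x ((R:ℂ) + y * Complex.I))) atTop (nhds 0) := by
  have := intervalIntegral.tendsto_integral_filter_of_dominated_convergence
    (μ := volume) (a := 0) (b := 1) (l := (atTop : Filter ℝ))
    (F := fun (R y : ℝ) => airyE x ((R:ℂ) + y * Complex.I)) (f := fun _ => 0)
    (fun _ => Real.exp (1 + |x|)) ?_ ?_ ?_ ?_
  · simpa using this
  · refine Eventually.of_forall fun R => Continuous.aestronglyMeasurable ?_
    unfold airyE; fun_prop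
  · refine Eventually.of_forall fun R => Eventually.of_forall fun y hy => ?_
    rw [uIoc_of_le zero_le_one] at hy
    obtain ⟨h0, h1⟩ := hy
    rw [airyE_norm]
    apply Real.exp_le_exp.2
    have a1 : 0 ≤ y * R ^ 2 := by positivity
    have a2 : y ^ 3 ≤ 1 := pow_le_one₀ h0.le h1
    have a3 : -(x * y) ≤ |x| := by
      have : |x * y| ≤ |x| := by
        rw [abs_mul, abs_of_pos h0]
        exact mul_le_of_le_one_right (abs_nonneg x) h1
      exact (neg_le_abs _).trans this
    linarith
  · exact intervalIntegrable_const
  · refine Eventually.of_forall fun y hy => ?_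
    rw [uIoc_of_le zero_le_one] at hy
    rw [tendsto_zero_iff_norm_tendsto_zero]
    simp only [airyE_norm]
    apply Real.tendsto_exp_atBot.comp
    have : Tendsto (fun R : ℝ => y * R ^ 2) atTop atTop :=
      (tendsto_pow_atTop two_ne_zero).const_mul_atTop hy.1
    have := tendsto_atBot_add_const_right atTop (y ^ 3 / 3 - x * y)
      (tendsto_neg_atTop_atBot.comp this)
    refine this.congr fun R => ?_
    simp only [Function.comp]
    ring

theorem Ai_eq (x : ℝ) : Ai x = (1 / Real.pi) * (airyK 0 x).re := by
  unfold Ai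
  congr 1
  apply Tendsto.limUnder_eq
  simp only [airy_rect]
  have h1 := intervalIntegral_tendsto_integral_Ioi 0 (airy_integrable 0 x) tendsto_id
  have h2 := (Complex.continuous_re.tendsto _).comp h1
  have h3 := (Complex.continuous_im.tendsto _).comp (airy_side x)
  have h4 := h2.add h3
  simpa [airyK, Function.comp_def] using h4

theorem airy_re_deriv (n : ℕ) (x : ℝ) :
    HasDerivAt (fun x => (1 / Real.pi) * (airyK n x).re)
      ((1 / Real.pi) * (airyK (n + 1) x).re) x := by
  have := (Complex.reCLM.hasFDerivAt.comp_hasDerivAt x (airyK_deriv n x)).const_mul (1 / Real.pi)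
  simpa [Function.comp_def] using this

theorem airy_sq_tendsto (n : ℕ) :
    Tendsto (fun x => |x| * ((1 / Real.pi) * (airyK n x).re) ^ 2) atTop (nhds 0) := by
  set C := (1 / Real.pi) * (n.factorial * Real.exp (7 / 3)) with hC
  have key : Tendsto (fun x : ℝ => C ^ 2 * (x ^ 1 * Real.exp (-x))) atTop (nhds 0) := by
    simpa using (Real.tendsto_pow_mul_exp_neg_atTop_nhds_zero 1).const_mul (C ^ 2)
  refine tendsto_of_tendsto_of_tendsto_of_le_of_le' tendsto_const_nhds key
    (Eventually.of_forall fun t => by positivity) ?_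
  filter_upwards [eventually_gt_atTop 0] with x hx
  have h1 : |(airyK n x).re| ≤ n.factorial * Real.exp (7 / 3) * Real.exp (-x) :=
    (Complex.abs_re_le_norm _).trans (airyK_norm n x)
  have h2 : ((1 / Real.pi) * (airyK n x).re) ^ 2 ≤ (C * Real.exp (-x)) ^ 2 := by
    rw [← sq_abs, abs_mul, abs_of_pos (by positivity : 0 < 1 / Real.pi), hC, mul_assoc]
    gcongr
  have h3 : Real.exp (-x) ≤ 1 := Real.exp_le_one_iff.2 (by linarith)
  have h4 : Real.exp (-x) ^ 2 ≤ Real.exp (-x) := by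
    nlinarith [Real.exp_pos (-x)]
  rw [abs_of_pos hx]
  calc _ ≤ x * (C * Real.exp (-x)) ^ 2 := by gcongr
    _ = C ^ 2 * (x ^ 1 * Real.exp (-x) ^ 2) := by ring
    _ ≤ _ := by gcongr

/-- For every `a < 0` with `Ai(a) = 0`, the translate `x ↦ Ai(x + a)` is square-integrable on
`(0,∞)` and `∫₀^∞ Ai(x + a)² dx = (Ai'(a))²`. -/
theorem airy_translate_l2_norm (a : ℝ) (ha : a < 0) (hzero : Ai a = 0) :
    MeasureTheory.IntegrableOn (fun x : ℝ => (Ai (x + a)) ^ 2) (Set.Ioi 0) ∧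
    (∫ x in Set.Ioi (0:ℝ), (Ai (x + a)) ^ 2) = (deriv Ai a) ^ 2 := by
  have hAi : Ai = fun x => (1 / Real.pi) * (airyK 0 x).re := funext Ai_eq
  set B : ℝ → ℝ := fun x => (1 / Real.pi) * (airyK 1 x).re with hB
  have hA' : ∀ x, HasDerivAt Ai (B x) x := fun x => by
    rw [hAi]; exact airy_re_deriv 0 x
  have hB' : ∀ x, HasDerivAt B (x * Ai x) x := fun x => by
    have := airy_re_deriv 1 x
    rw [show (1 + 1 : ℕ) = 2 from rfl, airyK_ode] at this
    refine this.congr_deriv ?_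
    rw [Ai_eq]; ring
  have hG : ∀ x, HasDerivAt (fun x => x * Ai x ^ 2 - B x ^ 2) (Ai x ^ 2) x := fun x => by
    have := ((hasDerivAt_id x).mul ((hA' x).pow 2)).sub ((hB' x).pow 2)
    refine this.congr_deriv ?_
    simp
    ring
  have hG0 : Tendsto (fun x => x * Ai x ^ 2 - B x ^ 2) atTop (nhds 0) := by
    have h0 := airy_sq_tendsto 0
    have h1 := airy_sq_tendsto 1
    have h1' : Tendsto (fun x => B x ^ 2) atTop (nhds 0) := by
      refine tendsto_of_tendsto_of_tendsto_of_le_of_le' tendsto_const_nhds h1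
        (Eventually.of_forall fun t => by positivity) ?_
      filter_upwards [eventually_ge_atTop 1] with x hx
      exact le_mul_of_one_le_left (sq_nonneg _) (hx.trans (le_abs_self x))
    have h0' : Tendsto (fun x => x * Ai x ^ 2) atTop (nhds 0) := by
      refine h0.congr' ?_
      filter_upwards [eventually_ge_atTop 0] with x hx
      rw [abs_of_nonneg hx, Ai_eq]
    simpa using h0'.sub h1'
  have hd : ∀ x ∈ Ici (0:ℝ), HasDerivAt (fun x => (x + a) * Ai (x + a) ^ 2 - B (x + a) ^ 2)
      (Ai (x + a) ^ 2) x := fun x _ => (hG (x + a)).comp_add_const x a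
  have ht : Tendsto (fun x => (x + a) * Ai (x + a) ^ 2 - B (x + a) ^ 2) atTop (nhds 0) :=
    hG0.comp (tendsto_atTop_add_const_right atTop a tendsto_id)
  refine ⟨integrableOn_Ioi_deriv_of_nonneg' hd (fun x _ => sq_nonneg _) ht, ?_⟩
  rw [integral_Ioi_of_hasDerivAt_of_nonneg' hd (fun x _ => sq_nonneg _) ht, (hA' a).deriv]
  simp [hzero]
end

section
/- There exists a numerical constant C > 0 such that for every n ≥ 1, ∫₀^∞ x·|Ai(x − αₙ)| dx ≤ C·n^{4/3}·|Ai'(−αₙ)|; that is, with ψₙ(x) = Ai(x − αₙ)/|Ai'(−αₙ)|, one has ⟨|ψₙ|, x⟩_{L²(0,∞)} ≤ C·n^{4/3} for all n ≥ 1. -/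
open MeasureTheory Filter Set

open Topology

noncomputable def AiC (n : ℕ) (x : ℝ) : ℝ :=
  ∫ t in Ioi (0:ℝ), t ^ n * Real.exp (-t ^ 2) * Real.cos (t ^ 3 / 3 + (x - 1) * t)
noncomputable def AiS (n : ℕ) (x : ℝ) : ℝ :=
  ∫ t in Ioi (0:ℝ), t ^ n * Real.exp (-t ^ 2) * Real.sin (t ^ 3 / 3 + (x - 1) * t)

lemma ai_gint (n : ℕ) : IntegrableOn (fun t : ℝ => t ^ n * Real.exp (-t ^ 2)) (Ioi 0) := by
  have h := (integrable_rpow_mul_exp_neg_mul_sq (b := 1) one_pos (s := n)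
    (by have : (0:ℝ) ≤ n := n.cast_nonneg
        linarith)).integrableOn (s := Ioi 0)
  simpa using h

lemma ai_cint (n : ℕ) (x : ℝ) : IntegrableOn
    (fun t : ℝ => t ^ n * Real.exp (-t ^ 2) * Real.cos (t ^ 3 / 3 + (x - 1) * t)) (Ioi 0) := by
  refine Integrable.mono (ai_gint n) (by fun_prop) (ae_of_all _ fun t => ?_)
  rw [norm_mul]
  exact mul_le_of_le_one_right (norm_nonneg _) (Real.abs_cos_le_one _)

lemma ai_sint (n : ℕ) (x : ℝ) : IntegrableOn
    (fun t : ℝ => t ^ n * Real.exp (-t ^ 2) * Real.sin (t ^ 3 / 3 + (x - 1) * t)) (Ioi 0) := by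
  refine Integrable.mono (ai_gint n) (by fun_prop) (ae_of_all _ fun t => ?_)
  rw [norm_mul]
  exact mul_le_of_le_one_right (norm_nonneg _) (Real.abs_sin_le_one _)

lemma ai_hasDeriv_C (n : ℕ) (x : ℝ) : HasDerivAt (AiC n) (-AiS (n+1) x) x := by
  have h := (hasDerivAt_integral_of_dominated_loc_of_deriv_le (μ := volume.restrict (Ioi (0:ℝ)))
    (F := fun x t : ℝ => t ^ n * Real.exp (-t ^ 2) * Real.cos (t ^ 3 / 3 + (x - 1) * t))
    (F' := fun x t : ℝ => -(t ^ (n+1) * Real.exp (-t ^ 2) * Real.sin (t ^ 3 / 3 + (x - 1) * t)))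
    (x₀ := x) (s := univ) (bound := fun t => ‖t ^ (n+1) * Real.exp (-t ^ 2)‖) univ_mem
    (Eventually.of_forall fun y => (ai_cint n y).aestronglyMeasurable) (ai_cint n x)
    (ai_sint (n+1) x).neg.aestronglyMeasurable
    (ae_of_all _ fun t y _ => by
      rw [norm_neg, norm_mul]
      exact mul_le_of_le_one_right (norm_nonneg _) (Real.abs_sin_le_one _))
    (ai_gint (n+1)).norm
    (ae_of_all _ fun t y _ => by
      have h1 : HasDerivAt (fun y : ℝ => t ^ 3 / 3 + (y - 1) * t) t y := by
        simpa using (((hasDerivAt_id y).sub_const 1).mul_const t).const_add (t^3/3)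
      refine HasDerivAt.congr_deriv ((h1.cos.const_mul (t ^ n * Real.exp (-t ^ 2)))) ?_
      ring)).2
  rw [integral_neg] at h
  exact h

lemma ai_hasDeriv_S (n : ℕ) (x : ℝ) : HasDerivAt (AiS n) (AiC (n+1) x) x := by
  have h := (hasDerivAt_integral_of_dominated_loc_of_deriv_le (μ := volume.restrict (Ioi (0:ℝ)))
    (F := fun x t : ℝ => t ^ n * Real.exp (-t ^ 2) * Real.sin (t ^ 3 / 3 + (x - 1) * t))
    (F' := fun x t : ℝ => (t ^ (n+1) * Real.exp (-t ^ 2) * Real.cos (t ^ 3 / 3 + (x - 1) * t)))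
    (x₀ := x) (s := univ) (bound := fun t => ‖t ^ (n+1) * Real.exp (-t ^ 2)‖) univ_mem
    (Eventually.of_forall fun y => (ai_sint n y).aestronglyMeasurable) (ai_sint n x)
    (ai_cint (n+1) x).aestronglyMeasurable
    (ae_of_all _ fun t y _ => by
      rw [norm_mul]
      exact mul_le_of_le_one_right (norm_nonneg _) (Real.abs_cos_le_one _))
    (ai_gint (n+1)).norm
    (ae_of_all _ fun t y _ => by
      have h1 : HasDerivAt (fun y : ℝ => t ^ 3 / 3 + (y - 1) * t) t y := by
        simpa using (((hasDerivAt_id y).sub_const 1).mul_const t).const_add (t^3/3)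
      refine HasDerivAt.congr_deriv ((h1.sin.const_mul (t ^ n * Real.exp (-t ^ 2)))) ?_
      ring)).2
  exact h

lemma ai_parts (x : ℝ) : AiC 2 x + (x - 1) * AiC 0 x - 2 * AiS 1 x = 0 := by
  have hd : ∀ t ∈ Ici (0:ℝ), HasDerivAt
      (fun t : ℝ => Real.exp (-t ^ 2) * Real.sin (t ^ 3 / 3 + (x - 1) * t))
      (t ^ 2 * Real.exp (-t ^ 2) * Real.cos (t ^ 3 / 3 + (x - 1) * t)
       + (x - 1) * (t ^ 0 * Real.exp (-t ^ 2) * Real.cos (t ^ 3 / 3 + (x - 1) * t))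
       - 2 * (t ^ 1 * Real.exp (-t ^ 2) * Real.sin (t ^ 3 / 3 + (x - 1) * t))) t := by
    intro t _
    have h1 : HasDerivAt (fun t : ℝ => t ^ 3 / 3 + (x - 1) * t) (t ^ 2 + (x - 1)) t := by
      refine HasDerivAt.congr_deriv (((hasDerivAt_pow 3 t).div_const 3).add ((hasDerivAt_id t).const_mul (x-1))) ?_
      simp
    have h2 : HasDerivAt (fun t : ℝ => - t ^ 2) (-(2 * t)) t := by
      refine HasDerivAt.congr_deriv ((hasDerivAt_pow 2 t).neg) ?_
      simp
    refine HasDerivAt.congr_deriv (h2.exp.mul h1.sin) ?_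
    ring
  have ht : Tendsto (fun t : ℝ => Real.exp (-t ^ 2) * Real.sin (t ^ 3 / 3 + (x - 1) * t))
      atTop (𝓝 0) := by
    have h0 : Tendsto (fun t : ℝ => Real.exp (-t ^ 2)) atTop (𝓝 0) :=
      Real.tendsto_exp_neg_atTop_nhds_zero.comp (tendsto_pow_atTop two_ne_zero)
    refine squeeze_zero_norm (fun t => ?_) h0
    rw [norm_mul, Real.norm_eq_abs, Real.abs_exp]
    exact mul_le_of_le_one_right (Real.exp_pos _).le (Real.abs_sin_le_one _)
  have h := integral_Ioi_of_hasDerivAt_of_tendsto' hd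
    (((ai_cint 2 x).add ((ai_cint 0 x).const_mul _)).sub ((ai_sint 1 x).const_mul _)) ht
  have e1 := integral_sub ((ai_cint 2 x).add ((ai_cint 0 x).const_mul (x-1)))
    ((ai_sint 1 x).const_mul 2)
  have e2 := integral_add (ai_cint 2 x) ((ai_cint 0 x).const_mul (x-1))
  simp only [Pi.add_apply, integral_const_mul] at e1 e2
  rw [e1, e2] at h
  simpa [AiC, AiS] using h

lemma ai_tendsto (x : ℝ) : Tendsto
    (fun R : ℝ => ∫ t in (0:ℝ)..R, Real.cos (t ^ 3 / 3 + x * t)) atTop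
    (𝓝 (Real.exp (1/3) * Real.exp (-x) * AiC 0 x)) := by
  let f : ℂ → ℂ := fun z => Complex.exp (Complex.I * (z ^ 3 / 3 + x * z))
  have hfc : Continuous f := by fun_prop
  have hfd : Differentiable ℂ f := by fun_prop
  -- explicit value
  have hval : ∀ s y : ℝ, f (s + y * Complex.I) = Complex.exp
      (((- s^2 * y + y^3/3 - x * y : ℝ) : ℂ)
        + ((s^3/3 - s*y^2 + x * s : ℝ) : ℂ) * Complex.I) := by
    intro s y
    simp only [f]
    congr 1
    push_cast
    linear_combination (Complex.I * s * y^2 + s^2*y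
      + (Complex.I ^ 2 - 1) * (y:ℂ)^3/3 + x * y ) * (Complex.I_sq)
  have hre : ∀ s y : ℝ, (f (s + y * Complex.I)).re =
      Real.exp (- s^2 * y + y^3/3 - x * y) * Real.cos (s^3/3 - s*y^2 + x * s) := by
    intro s y
    rw [hval, Complex.exp_re]
    simp only [Complex.add_re, Complex.add_im, Complex.ofReal_re, Complex.ofReal_im,
      Complex.mul_I_re, Complex.mul_I_im, neg_zero, add_zero, zero_add]
  have him : ∀ s y : ℝ, (f (s + y * Complex.I)).im =
      Real.exp (- s^2 * y + y^3/3 - x * y) * Real.sin (s^3/3 - s*y^2 + x * s) := by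
    intro s y
    rw [hval, Complex.exp_im]
    simp only [Complex.add_re, Complex.add_im, Complex.ofReal_re, Complex.ofReal_im,
      Complex.mul_I_re, Complex.mul_I_im, neg_zero, add_zero, zero_add]
  have key : ∀ R : ℝ, (∫ t in (0:ℝ)..R, Real.cos (t ^ 3 / 3 + x * t)) =
      (∫ t in (0:ℝ)..R, Real.exp (1/3) * Real.exp (-x) *
        (t ^ 0 * Real.exp (-t^2) * Real.cos (t ^ 3 / 3 + (x - 1) * t)))
      + ∫ y in (0:ℝ)..1, Real.exp (- R^2 * y + y^3/3 - x * y) *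
          Real.sin (R^3/3 - R*y^2 + x * R) := by
    intro R
    have h := Complex.integral_boundary_rect_eq_zero_of_differentiableOn f 0 (R + Complex.I)
      hfd.differentiableOn
    have reI : ∀ (g : ℝ → ℂ) (a b : ℝ), Continuous g →
        (∫ t in a..b, g t).re = ∫ t in a..b, (g t).re := fun g a b hg => by
      simpa using (Complex.reCLM.intervalIntegral_comp_comm (hg.intervalIntegrable a b)).symm
    have imI : ∀ (g : ℝ → ℂ) (a b : ℝ), Continuous g →
        (∫ t in a..b, g t).im = ∫ t in a..b, (g t).im := fun g a b hg => by
      simpa using (Complex.imCLM.intervalIntegral_comp_comm (hg.intervalIntegrable a b)).symm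
    have h2 := congrArg Complex.re h
    simp only [Complex.zero_re, Complex.zero_im, Complex.add_re, Complex.add_im,
      Complex.ofReal_re, Complex.ofReal_im, Complex.I_re, Complex.I_im, add_zero, zero_add,
      Complex.sub_re, smul_eq_mul, Complex.mul_re, zero_mul, one_mul, zero_sub] at h2
    rw [reI _ _ _ (by fun_prop), reI _ _ _ (by fun_prop), imI _ _ _ (by fun_prop),
      imI _ _ _ (by fun_prop)] at h2
    simp only [hre, him] at h2
    have e1 : ∀ t : ℝ, Real.exp (-t ^ 2 * 0 + 0 ^ 3 / 3 - x * 0) *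
      Real.cos (t ^ 3 / 3 - t * 0 ^ 2 + x * t) = Real.cos (t ^ 3 / 3 + x * t) := by
      intro t; simp
    have e2 : ∀ t : ℝ, Real.exp (-t ^ 2 * 1 + 1 ^ 3 / 3 - x * 1) *
      Real.cos (t ^ 3 / 3 - t * 1 ^ 2 + x * t) = Real.exp (1/3) * Real.exp (-x) *
        (t ^ 0 * Real.exp (-t^2) * Real.cos (t ^ 3 / 3 + (x - 1) * t)) := by
      intro t
      rw [show -t ^ 2 * 1 + 1 ^ 3 / 3 - x * 1 = 1/3 + -x + -t^2 by ring, Real.exp_add, Real.exp_add]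
      rw [show t ^ 3 / 3 - t * 1 ^ 2 + x * t = t ^ 3 / 3 + (x - 1) * t by ring]
      ring
    simp only [e1, e2] at h2
    simp at h2 ⊢
    linarith
  have l1 : Tendsto (fun R : ℝ => ∫ t in (0:ℝ)..R, Real.exp (1/3) * Real.exp (-x) *
        (t ^ 0 * Real.exp (-t^2) * Real.cos (t ^ 3 / 3 + (x - 1) * t))) atTop
      (𝓝 (Real.exp (1/3) * Real.exp (-x) * AiC 0 x)) := by
    have := intervalIntegral_tendsto_integral_Ioi 0
      ((ai_cint 0 x).const_mul (Real.exp (1/3) * Real.exp (-x))) tendsto_id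
    rw [integral_const_mul] at this
    exact this
  have l2 : Tendsto (fun R : ℝ => ∫ y in (0:ℝ)..1, Real.exp (- R^2 * y + y^3/3 - x * y) *
          Real.sin (R^3/3 - R*y^2 + x * R)) atTop (𝓝 (∫ y in (0:ℝ)..1, (0:ℝ))) := by
    refine intervalIntegral.tendsto_integral_filter_of_dominated_convergence
      (fun y => Real.exp (y^3/3 - x*y)) (Eventually.of_forall fun R => by fun_prop)
      (Eventually.of_forall fun R => ae_of_all _ fun y hy => ?_)
      ((by fun_prop : Continuous _).intervalIntegrable _ _)
      (ae_of_all _ fun y hy => ?_)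
    · rw [uIoc_of_le zero_le_one] at hy
      rw [norm_mul, Real.norm_eq_abs, Real.abs_exp]
      refine (mul_le_of_le_one_right (Real.exp_pos _).le (Real.abs_sin_le_one _)).trans ?_
      apply Real.exp_le_exp.2
      nlinarith [mul_nonneg (sq_nonneg R) hy.1.le]
    · rw [uIoc_of_le zero_le_one] at hy
      have h0 : Tendsto (fun R : ℝ => Real.exp (-(R^2 * y)) * Real.exp (y^3/3 - x*y)) atTop
          (𝓝 (0 * Real.exp (y^3/3 - x*y))) :=
        (Real.tendsto_exp_neg_atTop_nhds_zero.comp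
          ((tendsto_pow_atTop two_ne_zero).atTop_mul_const hy.1)).mul_const _
      rw [zero_mul] at h0
      refine squeeze_zero_norm (fun R => ?_) h0
      rw [norm_mul, Real.norm_eq_abs, Real.abs_exp, ← Real.exp_add]
      refine (mul_le_of_le_one_right (Real.exp_pos _).le (Real.abs_sin_le_one _)).trans ?_
      apply Real.exp_le_exp.2
      linarith
  have := l1.add l2
  simp only [intervalIntegral.integral_zero, add_zero] at this
  exact this.congr fun R => (key R).symm

noncomputable def AiK : ℝ := 1 / Real.pi * Real.exp (1/3)

lemma ai_eq : Ai = fun x => AiK * (Real.exp (-x) * AiC 0 x) := by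
  funext x
  rw [Ai, (ai_tendsto x).limUnder_eq, AiK]
  ring

noncomputable def AiD (x : ℝ) : ℝ := AiK * (Real.exp (-x) * (-AiC 0 x - AiS 1 x))

lemma ai_exp_neg (x : ℝ) : HasDerivAt (fun x : ℝ => Real.exp (-x)) (-Real.exp (-x)) x := by
  simpa using (hasDerivAt_neg x).exp

lemma ai_deriv (x : ℝ) : HasDerivAt Ai (AiD x) x := by
  rw [ai_eq, AiD]
  refine HasDerivAt.congr_deriv (((ai_exp_neg x).mul (ai_hasDeriv_C 0 x)).const_mul AiK) ?_
  ring

lemma ai_deriv2 (x : ℝ) : HasDerivAt AiD (x * Ai x) x := by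
  have h := ((ai_exp_neg x).mul ((ai_hasDeriv_C 0 x).neg.sub (ai_hasDeriv_S 1 x))).const_mul AiK
  refine HasDerivAt.congr_deriv (h.congr_of_eventuallyEq (Eventually.of_forall fun y => rfl)) ?_
  rw [ai_eq]
  have := ai_parts x
  simp only [Pi.sub_apply, Pi.neg_apply, zero_add, Nat.reduceAdd]
  linear_combination (-AiK * Real.exp (-x)) * this

lemma ai_bound : ∃ M : ℝ, 0 < M ∧ ∀ x, |Ai x| ≤ M * Real.exp (-x) := by
  refine ⟨|AiK| * (∫ t in Ioi (0:ℝ), ‖t ^ 0 * Real.exp (-t ^ 2)‖) + 1, by positivity, fun x => ?_⟩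
  have h : |AiC 0 x| ≤ ∫ t in Ioi (0:ℝ), ‖t ^ 0 * Real.exp (-t ^ 2)‖ := by
    refine norm_integral_le_of_norm_le (μ := volume.restrict (Ioi (0:ℝ))) (f := fun t : ℝ => t ^ 0 * Real.exp (-t ^ 2) * Real.cos (t ^ 3 / 3 + (x - 1) * t)) (ai_gint 0).norm (ae_of_all _ fun t => ?_)
    rw [norm_mul]
    exact mul_le_of_le_one_right (norm_nonneg _) (Real.abs_cos_le_one _)
  rw [ai_eq]
  simp only [abs_mul, Real.abs_exp]
  have := mul_le_mul_of_nonneg_left h (mul_nonneg (abs_nonneg AiK) (Real.exp_pos (-x)).le)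
  nlinarith [Real.exp_pos (-x)]

lemma ai_energy_deriv (x : ℝ) :
    HasDerivAt (fun x => AiD x ^ 2 - x * Ai x ^ 2) (-(Ai x) ^ 2) x := by
  refine HasDerivAt.congr_deriv
    (((ai_deriv2 x).pow 2).sub ((hasDerivAt_id x).mul ((ai_deriv x).pow 2))) ?_
  simp
  ring

lemma ai_energy_anti : Antitone (fun x => AiD x ^ 2 - x * Ai x ^ 2) := by
  refine antitone_of_deriv_nonpos (fun x => (ai_energy_deriv x).differentiableAt) fun x => ?_
  rw [(ai_energy_deriv x).deriv]
  nlinarith [sq_nonneg (Ai x)]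

lemma ai_cont : Continuous Ai := continuous_iff_continuousAt.2 fun x => (ai_deriv x).continuousAt

/-- Sturm comparison for a positive solution. -/
lemma ai_sturm_aux (a σ : ℝ) (ha : 0 < a) (hpos : ∀ x ∈ Ico (-(a + Real.pi / √a)) (-a),
    0 < σ * Ai x) : False := by
  set k := √a with hk
  have hk0 : 0 < k := Real.sqrt_pos.2 ha
  have hk2 : k ^ 2 = a := Real.sq_sqrt ha.le
  set l := -(a + Real.pi / k) with hl
  have hlr : l < -a := by
    have : 0 < Real.pi / k := div_pos Real.pi_pos hk0
    linarith
  have hkr : k * (-a - l) = Real.pi := by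
    rw [hl]; field_simp; ring
  have hw : ∀ x, HasDerivAt (fun x => k * (x - l)) k x := fun x => by
    simpa using ((hasDerivAt_id x).sub_const l).const_mul k
  have hW : ∀ x, HasDerivAt (fun x => AiD x * Real.sin (k * (x - l))
      - Ai x * (k * Real.cos (k * (x - l)))) ((x + a) * Ai x * Real.sin (k * (x - l))) x := by
    intro x
    refine HasDerivAt.congr_deriv (((ai_deriv2 x).mul (hw x).sin).sub
      ((ai_deriv x).mul ((hw x).cos.const_mul k))) ?_
    rw [← hk2]; ring
  have hanti : AntitoneOn (fun x => σ * (AiD x * Real.sin (k * (x - l))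
      - Ai x * (k * Real.cos (k * (x - l))))) (Icc l (-a)) := by
    refine antitoneOn_of_deriv_nonpos (convex_Icc _ _)
      (fun x _ => ((hW x).const_mul σ).continuousAt.continuousWithinAt)
      (fun x _ => ((hW x).const_mul σ).differentiableAt.differentiableWithinAt) fun x hx => ?_
    rw [interior_Icc] at hx
    rw [((hW x).const_mul σ).deriv]
    have h1 : 0 < σ * Ai x := hpos x ⟨hx.1.le, hx.2⟩
    have h2 : 0 ≤ Real.sin (k * (x - l)) := by
      apply Real.sin_nonneg_of_nonneg_of_le_pi
      · exact mul_nonneg hk0.le (by linarith [hx.1])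
      · rw [← hkr]
        exact mul_le_mul_of_nonneg_left (by linarith [hx.2]) hk0.le
    have h3 : x + a ≤ 0 := by linarith [hx.2]
    have := mul_nonneg (mul_nonneg (neg_nonneg.2 h3) h1.le) h2
    nlinarith
  have h := hanti (left_mem_Icc.2 hlr.le) (right_mem_Icc.2 hlr.le) hlr.le
  simp only [hkr, sub_self, mul_zero, Real.sin_zero, Real.cos_zero, Real.sin_pi, Real.cos_pi] at h
  have hL : 0 < σ * Ai l := hpos l ⟨le_rfl, hlr⟩
  have hR : 0 ≤ σ * Ai (-a) := by
    have hc : ContinuousWithinAt (fun x => σ * Ai x) (Iio (-a)) (-a) :=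
      (continuous_const.mul ai_cont).continuousWithinAt
    refine ge_of_tendsto hc ?_
    filter_upwards [Ioo_mem_nhdsLT hlr] with x hx
    exact (hpos x ⟨hx.1.le, hx.2⟩).le
  nlinarith [mul_pos hk0 hL, mul_nonneg hk0.le hR]

lemma ai_sturm (a : ℝ) (ha : 0 < a) : ∃ x ∈ Ico (-(a + Real.pi / √a)) (-a), Ai x = 0 := by
  by_contra! hne
  have hlr : -(a + Real.pi / √a) < -a := by
    have : 0 < Real.pi / √a := div_pos Real.pi_pos (Real.sqrt_pos.2 ha)
    linarith
  refine ai_sturm_aux a (Ai (-(a + Real.pi / √a))) ha fun x hx => ?_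
  have hl := hne _ ⟨le_rfl, hlr⟩
  have hx0 := hne x hx
  by_contra! hle
  have hsub : Icc (-(a + Real.pi / √a)) x ⊆ Ico (-(a + Real.pi / √a)) (-a) :=
    fun y hy => ⟨hy.1, hy.2.trans_lt hx.2⟩
  rcases lt_or_gt_of_ne hl with h | h
  · have : 0 ≤ Ai x := by nlinarith
    obtain ⟨y, hy, h0⟩ := intermediate_value_Icc hx.1 ai_cont.continuousOn ⟨h.le, this⟩
    exact hne y (hsub hy) h0
  · have : Ai x ≤ 0 := by nlinarith
    obtain ⟨y, hy, h0⟩ := intermediate_value_Icc' hx.1 ai_cont.continuousOn ⟨this, h.le⟩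
    exact hne y (hsub hy) h0

lemma ai_tail (a : ℝ) (ha : 0 < a) :
    IntegrableOn (fun x : ℝ => x * Real.exp (-(x - a))) (Ioi a) ∧
    ∫ x in Ioi a, x * Real.exp (-(x - a)) = a + 1 := by
  have hd : ∀ x ∈ Ici a, HasDerivAt (fun x : ℝ => -((x + 1) * Real.exp (-(x - a))))
      (x * Real.exp (-(x - a))) x := by
    intro x _
    have h1 : HasDerivAt (fun x : ℝ => Real.exp (-(x - a))) (-Real.exp (-(x - a))) x := by
      simpa using (((hasDerivAt_id x).sub_const a).neg).exp
    refine HasDerivAt.congr_deriv ((((hasDerivAt_id x).add_const 1).mul h1).neg) ?_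
    simp
    ring
  have hp : ∀ x ∈ Ioi a, 0 ≤ x * Real.exp (-(x - a)) := fun x hx =>
    mul_nonneg (ha.trans hx).le (Real.exp_pos _).le
  have ht : Tendsto (fun x : ℝ => -((x + 1) * Real.exp (-(x - a)))) atTop (𝓝 0) := by
    have h1 := Real.tendsto_pow_mul_exp_neg_atTop_nhds_zero 1
    have h0 := Real.tendsto_exp_neg_atTop_nhds_zero
    have := ((h1.add h0).mul_const (Real.exp a)).neg
    simp only [add_zero, zero_mul, neg_zero] at this
    refine this.congr fun x => ?_
    rw [show -(x - a) = -x + a by ring, Real.exp_add]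
    ring
  refine ⟨integrableOn_Ioi_deriv_of_nonneg' hd hp ht, ?_⟩
  rw [integral_Ioi_of_hasDerivAt_of_nonneg' hd hp ht]
  simp

lemma ai_growth (α : ℕ → ℝ)
    (hpos : ∀ n : ℕ, 1 ≤ n → 0 < α n)
    (hmono : ∀ m n : ℕ, 1 ≤ m → m < n → α m < α n)
    (hall : ∀ x : ℝ, Ai x = 0 → ∃ n : ℕ, 1 ≤ n ∧ x = -(α n)) :
    ∃ K : ℝ, 0 < K ∧ ∀ n : ℕ, 1 ≤ n → α n ^ 2 ≤ K * (n : ℝ) ^ ((4:ℝ)/3) := by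
  have hge : ∀ n, 1 ≤ n → α 1 ≤ α n := fun n hn => by
    rcases hn.eq_or_lt with rfl | h
    · exact le_rfl
    · exact (hmono 1 n le_rfl h).le
  have hstep : ∀ n, 1 ≤ n → α (n+1) ≤ α n + Real.pi / √(α n) := by
    intro n hn
    obtain ⟨x, hx, h0⟩ := ai_sturm (α n) (hpos n hn)
    obtain ⟨m, hm, rfl⟩ := hall x h0
    have h1 : α n < α m := by linarith [hx.2]
    have h2 : n < m := by
      by_contra! hle
      rcases hle.eq_or_lt with rfl | h
      · exact lt_irrefl _ h1
      · exact absurd (hmono m n hm h) (not_lt.2 h1.le)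
    have h3 : α (n+1) ≤ α m := by
      rcases (Nat.succ_le_of_lt h2).eq_or_lt with h | h
      · rw [← h]
      · exact (hmono (n+1) m (by omega) h).le
    linarith [hx.1]
  have h1 := hpos 1 le_rfl
  set b1 := α 1 * √(α 1) with hb1
  have hb1p : 0 < b1 := mul_pos h1 (Real.sqrt_pos.2 h1)
  set L := max b1 ((2 + Real.pi / b1) * Real.pi) with hL
  have hb : ∀ n : ℕ, 1 ≤ n → α n * √(α n) ≤ L * n := by
    intro n hn
    induction n, hn using Nat.le_induction with
    | base =>
      rw [Nat.cast_one, mul_one]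
      exact le_max_left b1 ((2 + Real.pi / b1) * Real.pi)
    | succ n hn ih =>
      have ha := hpos n hn
      set a := α n with haa
      set s := √a with hs
      have hs0 : 0 < s := Real.sqrt_pos.2 ha
      have hs2 : s ^ 2 = a := Real.sq_sqrt ha.le
      have hb : b1 ≤ a * s := mul_le_mul (hge n hn) (Real.sqrt_le_sqrt (hge n hn))
        (Real.sqrt_nonneg _) ha.le
      have hasp : 0 < a * s := mul_pos ha hs0
      set t := Real.pi / (a * s) with ht
      have ht0 : 0 < t := div_pos Real.pi_pos hasp
      have htb : t ≤ Real.pi / b1 := div_le_div_of_nonneg_left Real.pi_pos.le hb1p hb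
      have hat : t * (a * s) = Real.pi := by rw [ht]; field_simp
      have e1 : α (n+1) ≤ a * (1 + t) := by
        refine (hstep n hn).trans (le_of_eq ?_)
        rw [← hat, ← haa, ← hs]; field_simp
      have e2 : √(α (n+1)) ≤ s * (1 + t) := by
        apply Real.sqrt_le_iff.2 ⟨by positivity, ?_⟩
        refine e1.trans ?_
        rw [mul_pow, hs2]
        apply mul_le_mul_of_nonneg_left _ ha.le
        nlinarith
      have e3 : α (n+1) * √(α (n+1)) ≤ (a * (1 + t)) * (s * (1 + t)) :=
        mul_le_mul e1 e2 (Real.sqrt_nonneg _) (by positivity)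
      have e4 : (a * (1 + t)) * (s * (1 + t)) = a * s + (2 + t) * Real.pi := by
        rw [← hat]; ring
      have e5 : (2 + t) * Real.pi ≤ (2 + Real.pi / b1) * Real.pi :=
        mul_le_mul_of_nonneg_right (by linarith) Real.pi_pos.le
      have e6 : (2 + Real.pi / b1) * Real.pi ≤ L := le_max_right _ _
      push_cast
      linarith
  have hL0 : 0 < L := lt_of_lt_of_le hb1p (le_max_left _ _)
  refine ⟨L ^ ((4:ℝ)/3), Real.rpow_pos_of_pos hL0 _, fun n hn => ?_⟩
  have ha := hpos n hn
  rw [← Real.mul_rpow hL0.le n.cast_nonneg]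
  refine le_trans (le_of_eq ?_) (Real.rpow_le_rpow (by positivity) (hb n hn) (by norm_num))
  rw [Real.sqrt_eq_rpow]
  nth_rewrite 2 [← Real.rpow_one (α n)]
  rw [← Real.rpow_add ha, ← Real.rpow_mul ha.le, ← Real.rpow_natCast]
  norm_num

theorem airy_eigenfunction_first_moment_bound (α : ℕ → ℝ)
    (hpos : ∀ n : ℕ, 1 ≤ n → 0 < α n)
    (hmono : ∀ m n : ℕ, 1 ≤ m → m < n → α m < α n)
    (hzero : ∀ n : ℕ, 1 ≤ n → Ai (-(α n)) = 0)
    (hall : ∀ x : ℝ, Ai x = 0 → ∃ n : ℕ, 1 ≤ n ∧ x = -(α n)) :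
    ∃ C : ℝ, 0 < C ∧ ∀ n : ℕ, 1 ≤ n →
      MeasureTheory.IntegrableOn (fun x : ℝ => x * |Ai (x - α n)|) (Set.Ioi 0) ∧
      (∫ x in Set.Ioi (0:ℝ), x * |Ai (x - α n)|)
        ≤ C * (n : ℝ) ^ ((4:ℝ)/3) * |deriv Ai (-(α n))| := by
  obtain ⟨K, hK, hgrow⟩ := ai_growth α hpos hmono hall
  obtain ⟨M, hM, hbd⟩ := ai_bound
  have hge : ∀ n, 1 ≤ n → α 1 ≤ α n := fun n hn => by
    rcases hn.eq_or_lt with rfl | h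
    · exact le_rfl
    · exact (hmono 1 n le_rfl h).le
  have h1 := hpos 1 le_rfl
  have hAi0 : Ai 0 ≠ 0 := fun h => by
    obtain ⟨n, hn, h⟩ := hall 0 h
    linarith [hpos n hn]
  -- nonvanishing derivative at the first zero
  have hD1 : 0 < |AiD (-(α 1))| := by
    rw [abs_pos]
    intro h0
    have hE : ∀ x ∈ Ioo (-(α 1)) 0, AiD x ^ 2 - x * Ai x ^ 2 = 0 := by
      intro x hx
      have h := ai_energy_anti hx.1.le
      simp only [h0, hzero 1 le_rfl] at h
      nlinarith [sq_nonneg (AiD x), mul_nonneg (neg_nonneg.2 hx.2.le) (sq_nonneg (Ai x))]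
    have hz : ∀ x ∈ Ioo (-(α 1)) 0, Ai x = 0 := by
      intro x hx
      have h := hE x hx
      have h2 : -x * Ai x ^ 2 = 0 := by
        nlinarith [sq_nonneg (AiD x), mul_nonneg (neg_nonneg.2 hx.2.le) (sq_nonneg (Ai x))]
      have hx0 : -x ≠ 0 := by linarith [hx.2]
      simpa [hx.2.ne] using h2
    apply hAi0
    refine tendsto_nhds_unique (ai_cont.continuousWithinAt (s := Iio 0) (x := 0)) ?_
    refine tendsto_const_nhds.congr' ?_
    filter_upwards [Ioo_mem_nhdsLT (by linarith : -(α 1) < 0)] with x hx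
    exact (hz x hx).symm
  set D1 := |AiD (-(α 1))| with hD1d
  have hDn : ∀ n, 1 ≤ n → D1 ≤ |AiD (-(α n))| := by
    intro n hn
    have h := ai_energy_anti (neg_le_neg (hge n hn))
    simp only [hzero 1 le_rfl, hzero n hn] at h
    apply sq_le_sq.1
    simpa using h
  set Q := max 1 (M * Real.exp 1 / D1) with hQ
  have hQ1 : 1 ≤ Q := le_max_left _ _
  have hQM : M * Real.exp 1 ≤ Q * D1 := by
    rw [← div_le_iff₀ hD1]; exact le_max_right _ _
  have hQM' : M ≤ Q * D1 := by
    have : 1 ≤ Real.exp 1 := Real.one_le_exp zero_le_one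
    nlinarith
  set T := 1 + (1 / α 1 + 1 / α 1 ^ 2) with hT
  have hT0 : 0 < T := by positivity
  refine ⟨Q * T * K, by positivity, fun n hn => ?_⟩
  rw [(ai_deriv _).deriv]
  have ha := hpos n hn
  have hge1 := hge n hn
  have hD := hDn n hn
  have hz := hzero n hn
  have hgr := hgrow n hn
  set a := α n with haa
  set D := |AiD (-a)| with hDd
  have hD0 : 0 < D := hD1.trans_le hD
  have hQD : Q * D1 ≤ Q * D := mul_le_mul_of_nonneg_left hD (by linarith)
  -- pointwise bound
  have hpt : ∀ x ∈ Icc (-a) 0, |Ai x| ≤ Q * D := by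
    intro x hx
    rcases le_total x (-1) with hx1 | hx1
    · have h := ai_energy_anti hx.1
      simp only [hz] at h
      have h2 : Ai x ^ 2 ≤ D ^ 2 := by
        rw [hDd, sq_abs]
        nlinarith [sq_nonneg (AiD x), sq_nonneg (Ai x)]
      have h3 : |Ai x| ≤ D := abs_le_of_sq_le_sq h2 hD0.le
      nlinarith
    · have : Real.exp (-x) ≤ Real.exp 1 := Real.exp_le_exp.2 (by linarith)
      have := mul_le_mul_of_nonneg_left this hM.le
      linarith [hbd x]
  have hcont : Continuous (fun x : ℝ => x * |Ai (x - a)|) :=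
    continuous_id.mul (ai_cont.comp (continuous_id.sub continuous_const)).abs
  obtain ⟨ti, tv⟩ := ai_tail a ha
  have htpt : ∀ x ∈ Ioi a, x * |Ai (x - a)| ≤ (Q * D) * (x * Real.exp (-(x - a))) := by
    intro x hx
    have hx0 : 0 < x := ha.trans hx
    have h := (hbd (x - a)).trans
      (mul_le_mul_of_nonneg_right (hQM'.trans hQD) (Real.exp_pos (-(x - a))).le)
    have := mul_le_mul_of_nonneg_left h hx0.le
    linarith
  have hi1 : IntegrableOn (fun x : ℝ => x * |Ai (x - a)|) (Ioc 0 a) :=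
    (hcont.integrableOn_Icc).mono_set Ioc_subset_Icc_self
  have hi2 : IntegrableOn (fun x : ℝ => x * |Ai (x - a)|) (Ioi a) := by
    refine Integrable.mono' (ti.const_mul (Q * D)) hcont.aestronglyMeasurable ?_
    filter_upwards [ae_restrict_mem measurableSet_Ioi] with x hx
    rw [Real.norm_eq_abs, abs_of_nonneg (mul_nonneg (ha.trans hx).le (abs_nonneg _))]
    exact htpt x hx
  have hun : Ioc 0 a ∪ Ioi a = Ioi 0 := Ioc_union_Ioi_eq_Ioi ha.le
  refine ⟨hun ▸ hi1.union hi2, ?_⟩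
  rw [← hun, setIntegral_union Ioc_disjoint_Ioi_same
    measurableSet_Ioi hi1 hi2]
  have b1 : ∫ x in Ioc 0 a, x * |Ai (x - a)| ≤ Q * D * a ^ 2 := by
    have h : ∫ x in Ioc 0 a, x * |Ai (x - a)| ≤ ∫ x in Ioc 0 a, a * (Q * D) := by
      refine setIntegral_mono_on hi1 (integrableOn_const (by simp)) measurableSet_Ioc fun x hx => ?_
      exact mul_le_mul hx.2 (hpt _ ⟨by linarith [hx.1], by linarith [hx.2]⟩) (abs_nonneg _) ha.le
    refine h.trans (le_of_eq ?_)
    simp [ha.le]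
    ring
  have b2 : ∫ x in Ioi a, x * |Ai (x - a)| ≤ Q * D * (a + 1) := by
    rw [← tv, ← integral_const_mul]
    exact setIntegral_mono_on hi2 (ti.const_mul _) measurableSet_Ioi htpt
  have b3 : a ^ 2 + (a + 1) ≤ T * a ^ 2 := by
    have c1 : a ≤ 1 / α 1 * a ^ 2 := by
      rw [div_mul_eq_mul_div, le_div_iff₀ h1]; nlinarith
    have c2 : 1 ≤ 1 / α 1 ^ 2 * a ^ 2 := by
      rw [div_mul_eq_mul_div, le_div_iff₀ (by positivity)]; nlinarith
    rw [hT]; linarith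
  have hQD0 : 0 ≤ Q * D := by positivity
  calc _ ≤ Q * D * (a ^ 2 + (a + 1)) := by linarith
    _ ≤ Q * D * (T * a ^ 2) := mul_le_mul_of_nonneg_left b3 hQD0
    _ ≤ Q * D * (T * (K * (n : ℝ) ^ ((4:ℝ)/3))) := by gcongr
    _ = _ := by ring
end
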